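/- arXiv:0712.3733 — 3 statements merged into one kernel-verified Lean document; each statement's English description precedes it below -/
import Mathlib

section
/- Let R be a regular local ring with maximal ideal M, let J ⊆ R be a nonzero ideal, and let b, b' be positive integers. If the ideals J^{b'} and (J')^{b} have the same integral closure for another nonzero ideal J' ⊆ R, then ord(J)/b = ord(J')/b', where ord denotes the M-adic order of an ideal (the largest n with the ideal contained in M^n). -/
open IsLocalRing

/-- `R` is a regular local ring: the maximal ideal is generated by
`dim R` elements. -/
def IsRegularLocal (R : Type*) [CommRing R] [IsLocalRing R] : Prop :=
  ∃ s : Finset R, Ideal.span (s : Set R) = maximalIdeal R ∧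
    (s.card : WithBot (WithTop ℕ)) = ringKrullDim R

/-- The `M`-adic order of an ideal: the largest `n` with `I ⊆ M^n`. -/
noncomputable def ordI {R : Type*} [CommRing R] [IsLocalRing R] (I : Ideal R) : ℕ :=
  sSup {n : ℕ | I ≤ maximalIdeal R ^ n}

/-- `x` is integral over the ideal `I`: it satisfies an equation of integral
dependence `x^n + a₁ x^{n-1} + ⋯ + a_n = 0` with `a_i ∈ I^i`. -/
def IsIntegralOverIdeal {R : Type*} [CommRing R] (I : Ideal R) (x : R) : Prop :=
  ∃ (n : ℕ) (a : ℕ → R), 0 < n ∧ (∀ i, 1 ≤ i → i ≤ n → a i ∈ I ^ i) ∧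
    x ^ n + ∑ i ∈ Finset.Icc 1 n, a i * x ^ (n - i) = 0


namespace OrdAux

open MvPolynomial

lemma aeval_smul_homog {R A σ : Type*} [CommRing R] [CommRing A] [Algebra R A]
    {F : MvPolynomial σ R} {m : ℕ} (hF : F.IsHomogeneous m) (c : A) (v : σ → A) :
    aeval (fun i => c * v i) F = c ^ m * aeval v F := by
  rw [aeval_def, aeval_def, eval₂_eq, eval₂_eq, Finset.mul_sum]
  refine Finset.sum_congr rfl fun d hd => ?_
  have hdeg : ∑ i ∈ d.support, d i = m := by
    have := hF (mem_support_iff.mp hd)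
    rw [← this, Finsupp.weight_apply, Finsupp.sum]
    simp
  simp_rw [mul_pow]
  rw [Finset.prod_mul_distrib, Finset.prod_pow_eq_pow_sum, hdeg]
  ring

/-- the key exchange relation -/
lemma exchange {R σ : Type*} [CommRing R] (x : σ → R) (a : σ)
    (Q : Ideal (MvPolynomial σ R))
    (hQ : ∀ i, C (x i) * X a - C (x a) * X i ∈ Q)
    {F : MvPolynomial σ R} {m : ℕ} (hF : F.IsHomogeneous m) :
    X a ^ m * C (eval x F) - C (x a) ^ m * F ∈ Q := by
  rw [← Ideal.Quotient.eq]
  have h1 := aeval_smul_homog hF (Ideal.Quotient.mk Q (X a))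
    (fun i => Ideal.Quotient.mk Q (C (x i)))
  have h2 := aeval_smul_homog hF (Ideal.Quotient.mk Q (C (x a)))
    (fun i => Ideal.Quotient.mk Q (X i))
  have h3 : (fun i => Ideal.Quotient.mk Q (X a) * Ideal.Quotient.mk Q (C (x i)))
      = fun i => Ideal.Quotient.mk Q (C (x a)) * Ideal.Quotient.mk Q (X i) := by
    funext i
    rw [← map_mul, ← map_mul, Ideal.Quotient.eq, mul_comm (X a)]
    exact hQ i
  rw [h3, h2] at h1
  have h4 : aeval (fun i => Ideal.Quotient.mk Q (X i)) F = Ideal.Quotient.mk Q F := by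
    have : (aeval (fun i => Ideal.Quotient.mk Q (X i)) : MvPolynomial σ R →ₐ[R] _)
        = Ideal.Quotient.mkₐ R Q := by
      ext i; simp
    rw [this]; rfl
  have h5 : aeval (fun i => Ideal.Quotient.mk Q (C (x i))) F
      = Ideal.Quotient.mk Q (C (eval x F)) := by
    have : (fun i => Ideal.Quotient.mk Q (C (x i)))
      = fun i => algebraMap R (MvPolynomial σ R ⧸ Q) (x i) := rfl
    rw [this]
    have := aeval_algebraMap_apply (MvPolynomial σ R ⧸ Q) x F
    rw [Function.comp_def] at this
    rw [this, aeval_eq_eval]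
    rfl
  rw [h4, h5] at h1
  rw [map_mul, map_mul, map_pow, map_pow]
  exact h1.symm

lemma isPrime_map_C' {R σ : Type*} [CommRing R] [IsLocalRing R] :
    ((maximalIdeal R).map (C : R →+* MvPolynomial σ R)).IsPrime := by
  have h : RingHom.ker (residue R) = maximalIdeal R := ker_residue
  rw [← h, ← ker_map]
  exact RingHom.ker_isPrime _

lemma height_map_C' {R σ : Type*} [Finite σ] [CommRing R] [IsLocalRing R] [IsNoetherianRing R] :
    ((maximalIdeal R).map (C : R →+* MvPolynomial σ R)).height = (maximalIdeal R).height := by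
  have hp := isPrime_map_C' (R := R) (σ := σ)
  have : ((maximalIdeal R).map (C : R →+* MvPolynomial σ R)).LiesOver (maximalIdeal R) :=
    ⟨Ideal.IsMaximal.eq_of_le inferInstance Ideal.IsPrime.ne_top' Ideal.le_comap_map⟩
  rw [Ideal.height_eq_height_add_of_liesOver_of_hasGoingDown (maximalIdeal R)]
  rw [MvPolynomial.algebraMap_eq, Ideal.map_quotient_self, Ideal.height_bot, add_zero]

/-- quasi-regularity of a regular system of parameters -/
lemma quasiRegular {R : Type*} [CommRing R] [IsLocalRing R] [IsNoetherianRing R]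
    (s : Finset R) (hs : Ideal.span (s : Set R) = maximalIdeal R)
    (hd : (s.card : WithBot (WithTop ℕ)) = ringKrullDim R) (a : s)
    {F : MvPolynomial s R} {m : ℕ} (hF : F.IsHomogeneous m)
    (h : eval (fun i : s => (i : R)) F ∈ maximalIdeal R ^ (m + 1)) :
    F ∈ (maximalIdeal R).map (C : R →+* MvPolynomial s R) := by
  classical
  by_contra hFP
  have hP := isPrime_map_C' (R := R) (σ := s)
  set P := (maximalIdeal R).map (C : R →+* MvPolynomial s R) with hPdef
  set x : s → R := fun i => (i : R) with hx
  have hrange : Set.range x = (s : Set R) := by simp [hx]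
  have hxM : ∀ i, x i ∈ maximalIdeal R := fun i => by
    rw [← hs]; exact Ideal.subset_span i.2
  have hxP : ∀ i, C (x i) ∈ P := fun i => Ideal.mem_map_of_mem _ (hxM i)
  have hXa : (X a : MvPolynomial s R) ∉ P := by
    intro hc
    have := mem_map_C_iff.mp hc (Finsupp.single a 1)
    rw [coeff_X] at this
    exact (Ideal.IsPrime.ne_top' (I := maximalIdeal R))
      ((Ideal.eq_top_iff_one _).mpr (by simpa using this))
  let t : Finset (MvPolynomial s R) :=
    (Finset.univ.erase a).image fun i => C (x i) * X a - C (x a) * X i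
  have htc : t.card + 1 ≤ s.card := by
    have h1 : t.card ≤ (Finset.univ.erase a : Finset s).card := Finset.card_image_le
    rw [Finset.card_erase_of_mem (Finset.mem_univ a), Finset.card_univ, Fintype.card_coe] at h1
    have : 0 < s.card := Finset.card_pos.mpr ⟨a, a.2⟩
    omega
  let Q : Ideal (MvPolynomial s R) := Ideal.span (t : Set (MvPolynomial s R))
  have hQ : ∀ i, C (x i) * X a - C (x a) * X i ∈ Q := by
    intro i
    by_cases hi : i = a
    · subst hi; simp
    · exact Ideal.subset_span (Finset.mem_coe.mpr (Finset.mem_image.mpr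
        ⟨i, Finset.mem_erase.mpr ⟨hi, Finset.mem_univ _⟩, rfl⟩))
  have hQP : Q ≤ P := by
    refine Ideal.span_le.mpr fun f hf => ?_
    obtain ⟨i, -, rfl⟩ := Finset.mem_image.mp (Finset.mem_coe.mp hf)
    exact P.sub_mem (P.mul_mem_right _ (hxP i)) (P.mul_mem_right _ (hxP a))
  obtain ⟨G, hG, hGe⟩ : ∃ G : MvPolynomial s R, G.IsHomogeneous (m + 1) ∧ eval x G = eval x F := by
    rw [← hs, ← hrange] at h
    exact (Ideal.mem_span_pow_iff_exists_isHomogeneous x _).mp h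
  have e1 := exchange x a Q hQ hF
  have e2 := exchange x a Q hQ hG
  rw [hGe] at e2
  have e3 : C (x a) ^ m * (X a * F - C (x a) * G) ∈ Q := by
    have := Q.sub_mem e2 (Q.mul_mem_left (X a) e1)
    convert this using 1
    ring
  have e4 : X a * F - C (x a) * G ∉ P := by
    intro hc
    have := P.add_mem hc (P.mul_mem_right G (hxP a))
    rw [sub_add_cancel] at this
    rcases hP.mem_or_mem this with h' | h'
    exacts [hXa h', hFP h']
  have hmin : P ∈ Q.minimalPrimes := by
    refine ⟨⟨hP, hQP⟩, ?_⟩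
    rintro p ⟨hp, hQp⟩ hpP
    have ha : C (x a) ∈ p := by
      rcases hp.mem_or_mem (hQp e3) with h' | h'
      · exact hp.mem_of_pow_mem _ h'
      · exact absurd (hpP h') e4
    rw [hPdef, Ideal.map_le_iff_le_comap, ← hs, Ideal.span_le]
    intro r hr
    have := hQp (hQ ⟨r, hr⟩)
    have h2 := p.add_mem this (p.mul_mem_right (X ⟨r, hr⟩) ha)
    rw [sub_add_cancel] at h2
    rcases hp.mem_or_mem h2 with h' | h'
    · exact h'
    · exact absurd (hpP h') hXa
  have hh := Ideal.height_le_card_of_mem_minimalPrimes_span_finset hmin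
  rw [hPdef, height_map_C'] at hh
  have hdim := maximalIdeal_height_eq_ringKrullDim (R := R)
  rw [← hd] at hdim
  have h6 : (maximalIdeal R).height = (s.card : ℕ∞) := WithBot.coe_injective hdim
  rw [h6] at hh
  have : s.card ≤ t.card := by exact_mod_cast hh
  omega

lemma pow_prop {R : Type*} [CommRing R] [IsLocalRing R] [IsNoetherianRing R]
    (hreg : IsRegularLocal R) {y : R} {n m : ℕ}
    (h : y ^ n ∈ maximalIdeal R ^ (n * m + 1)) (hy : y ∈ maximalIdeal R ^ m) :
    y ∈ maximalIdeal R ^ (m + 1) := by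
  obtain ⟨s, hs, hd⟩ := hreg
  rcases s.eq_empty_or_nonempty with rfl | ⟨a, ha⟩
  · have hb : maximalIdeal R = ⊥ := by rw [← hs]; simp
    have h1 : y ∈ maximalIdeal R :=
      (inferInstance : (maximalIdeal R).IsPrime).mem_of_pow_mem n (Ideal.pow_le_self (by omega) h)
    rw [hb, Ideal.mem_bot] at h1
    rw [h1]; exact Ideal.zero_mem _
  · have hrange : Set.range (fun i : s => (i : R)) = (s : Set R) := by simp
    have hy' := hy
    rw [← hs, ← hrange] at hy'
    obtain ⟨F, hF, rfl⟩ := (Ideal.mem_span_pow_iff_exists_isHomogeneous _ _).mp hy'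
    rw [← map_pow, mul_comm n m] at h
    have h1 := quasiRegular s hs hd ⟨a, ha⟩ (hF.pow n) h
    have h2 := (isPrime_map_C' (R := R) (σ := s)).mem_of_pow_mem n h1
    rw [mem_map_C_iff] at h2
    rw [eval_eq]
    refine Ideal.sum_mem _ fun d hdm => ?_
    rw [pow_succ, mul_comm]
    refine Ideal.mul_mem_mul (h2 d) ?_
    have hdeg : ∑ i ∈ d.support, d i = m := by
      have := hF (mem_support_iff.mp hdm)
      rw [← this, Finsupp.weight_apply, Finsupp.sum]
      simp
    rw [← hdeg, ← Finset.prod_pow_eq_pow_sum]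
    refine Ideal.prod_mem_prod fun i _ => Ideal.pow_mem_pow ?_ _
    rw [← hs]; exact Ideal.subset_span i.2

/-- powers of the maximal ideal: if `y ∉ M^(m+1)` then `y^n ∉ M^(nm+1)` -/
lemma pow_prop' {R : Type*} [CommRing R] [IsLocalRing R] [IsNoetherianRing R]
    (hreg : IsRegularLocal R) {y : R} {n : ℕ} (m : ℕ)
    (h : y ^ n ∈ maximalIdeal R ^ (n * m + 1)) :
    y ∈ maximalIdeal R ^ (m + 1) := by
  induction m with
  | zero => exact pow_prop hreg h (by simp)
  | succ k ih =>
    refine pow_prop hreg h (ih (Ideal.pow_le_pow_right ?_ h))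
    rw [Nat.mul_succ]; omega

lemma integral_mem {R : Type*} [CommRing R] [IsLocalRing R] [IsNoetherianRing R]
    (hreg : IsRegularLocal R) {I : Ideal R} {k : ℕ} (hI : I ≤ maximalIdeal R ^ k) {z : R}
    (hz : IsIntegralOverIdeal I z) : z ∈ maximalIdeal R ^ k := by
  obtain ⟨n, c, hn, hc, he⟩ := hz
  suffices ∀ m ≤ k, z ∈ maximalIdeal R ^ m from this k le_rfl
  intro m
  induction m with
  | zero => intro _; simp
  | succ m ih =>
    intro hm
    have hzm := ih (by omega)
    apply pow_prop hreg (n := n) _ hzm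
    rw [eq_neg_of_add_eq_zero_left he]
    refine Ideal.neg_mem_iff _ |>.mpr (Ideal.sum_mem _ fun i hi => ?_)
    rw [Finset.mem_Icc] at hi
    have h1 : c i ∈ maximalIdeal R ^ (k * i) := by
      rw [pow_mul]; exact Ideal.pow_right_mono hI i (hc i hi.1 hi.2)
    have h2 : z ^ (n - i) ∈ maximalIdeal R ^ (m * (n - i)) := by
      rw [pow_mul]; exact Ideal.pow_mem_pow hzm _
    have h3 := Ideal.mul_mem_mul h1 h2
    rw [← pow_add] at h3
    refine Ideal.pow_le_pow_right ?_ h3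
    obtain ⟨j, rfl⟩ := Nat.exists_eq_add_of_le hi.2
    obtain ⟨l, rfl⟩ := Nat.exists_eq_add_of_le hm
    have := hi.1
    rw [Nat.add_sub_cancel_left]
    nlinarith [Nat.zero_le (l * i)]

lemma ord_spec {R : Type*} [CommRing R] [IsLocalRing R] [IsNoetherianRing R]
    {J : Ideal R} (hJ : J ≠ ⊥) :
    J ≤ maximalIdeal R ^ ordI J ∧ ¬ J ≤ maximalIdeal R ^ (ordI J + 1) := by
  obtain ⟨y, hy, hy0⟩ := Submodule.exists_mem_ne_zero_of_ne_bot hJ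
  have hbdd : BddAbove {n : ℕ | J ≤ maximalIdeal R ^ n} := by
    have : y ∉ ⨅ i : ℕ, maximalIdeal R ^ i := by
      rw [Ideal.iInf_pow_eq_bot_of_isLocalRing _ Ideal.IsPrime.ne_top']
      simpa using hy0
    rw [Ideal.mem_iInf] at this
    push Not at this
    obtain ⟨N, hN⟩ := this
    refine ⟨N, fun n hn => ?_⟩
    by_contra hlt
    exact hN (Ideal.pow_le_pow_right (by omega) (hn hy))
  refine ⟨Nat.sSup_mem (s := {n : ℕ | J ≤ maximalIdeal R ^ n}) ⟨0, by simp⟩ hbdd, fun h => ?_⟩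
  have := le_csSup hbdd (show ordI J + 1 ∈ {n : ℕ | J ≤ maximalIdeal R ^ n} from h)
  change ordI J + 1 ≤ ordI J at this
  omega

lemma half {R : Type*} [CommRing R] [IsLocalRing R] [IsNoetherianRing R]
    (hreg : IsRegularLocal R) (J J' : Ideal R) (hJ : J ≠ ⊥) (hJ' : J' ≠ ⊥)
    (b b' : ℕ)
    (hcl : ∀ x : R, IsIntegralOverIdeal (J' ^ b) x → IsIntegralOverIdeal (J ^ b') x) :
    b' * ordI J ≤ b * ordI J' := by
  by_contra! hlt
  have h1 := (ord_spec hJ).1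
  apply (ord_spec hJ').2
  intro y hy
  apply pow_prop' hreg (n := b)
  refine Ideal.pow_le_pow_right hlt ?_
  refine integral_mem hreg (I := J ^ b') ?_ (hcl _ ⟨1, fun _ => - y ^ b, one_pos, ?_, by simp⟩)
  · rw [mul_comm, pow_mul]; exact Ideal.pow_right_mono h1 _
  · intro i h1 h2
    obtain rfl : i = 1 := by omega
    rw [pow_one]
    exact (Ideal.neg_mem_iff _).mpr (Ideal.pow_mem_pow hy b)

end OrdAux

/-- in a regular local ring, if `J^{b'}` and `J'^{b}` have the same
integral closure then `ord(J)/b = ord(J')/b'`. -/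
theorem stmt0 {R : Type*} [CommRing R] [IsLocalRing R] [IsNoetherianRing R]
    (hreg : IsRegularLocal R) (J J' : Ideal R) (hJ : J ≠ ⊥) (hJ' : J' ≠ ⊥)
    (b b' : ℕ) (hb : 0 < b) (hb' : 0 < b')
    (hcl : ∀ x : R, IsIntegralOverIdeal (J ^ b') x ↔ IsIntegralOverIdeal (J' ^ b) x) :
    (ordI J : ℚ) / b = (ordI J' : ℚ) / b' := by
  have h1 := OrdAux.half hreg J J' hJ hJ' b b' fun x => (hcl x).2
  have h2 := OrdAux.half hreg J' J hJ' hJ b' b fun x => (hcl x).1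
  have h3 : ordI J * b' = ordI J' * b := by
    rw [mul_comm, mul_comm _ b]; exact le_antisymm h1 h2
  have hbq : (b : ℚ) ≠ 0 := by positivity
  have hbq' : (b' : ℚ) ≠ 0 := by positivity
  rw [div_eq_div_iff hbq hbq']
  exact_mod_cast h3
end

section
/- Let R be a regular local ring with maximal ideal M and residue characteristic arbitrary, and let G = ⊕_{k≥0} I_k W^k ⊆ R[W] be a graded subalgebra with I_0 = R. Define Sing condition at R: ord(I_k) ≥ k for all k ≥ 1. If G and G' are graded subalgebras of R[W] with the same integral closure in R[W], then the Sing condition holds for G if and only if it holds for G'. -/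
open IsLocalRing

open Polynomial

/-- The singular-locus condition at the regular local ring `R` for a graded
subalgebra `G = ⊕ I_k W^k ⊆ R[W]` : `ord(I_k) ≥ k` for all `k ≥ 1`. -/
def SingCond {R : Type*} [CommRing R] [IsLocalRing R] (G : Subalgebra R (Polynomial R)) : Prop :=
  ∀ k, 1 ≤ k → ∀ c : R, C c * X ^ k ∈ G → c ∈ maximalIdeal R ^ k

/-- A subalgebra of `R[W]` is graded if it is stable under taking homogeneous
components. -/
def IsGradedSub {R : Type*} [CommRing R] (G : Subalgebra R (Polynomial R)) : Prop :=
  ∀ p ∈ G, ∀ k, C (p.coeff k) * X ^ k ∈ G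

/-- Homogeneity of evaluation. -/
lemma aux_eval_smul {σ R A : Type*} [CommRing R] [CommRing A] (φ : R →+* A)
    {F : MvPolynomial σ R} {n : ℕ} (hF : F.IsHomogeneous n) (r : A) (v : σ → A) :
    MvPolynomial.eval₂ φ (fun j => r * v j) F = r ^ n * MvPolynomial.eval₂ φ v F := by
  rw [MvPolynomial.eval₂_eq, MvPolynomial.eval₂_eq, Finset.mul_sum]
  refine Finset.sum_congr rfl fun d hd => ?_
  have h : d.degree = n := by
    have := hF (MvPolynomial.mem_support_iff.mp hd)
    rw [Finsupp.degree_eq_weight_one]; exact this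
  simp only [mul_pow, Finset.prod_mul_distrib, Finset.prod_pow_eq_pow_sum]
  rw [show ∑ i ∈ d.support, d i = n from h]
  ring

/-- Elements of `I ^ n` are values of homogeneous forms of degree `n`. -/
lemma aux_exists_form {σ R : Type*} [CommRing R] (x : σ → R) (n : ℕ) :
    ∀ a ∈ (Ideal.span (Set.range x)) ^ n, ∃ F : MvPolynomial σ R,
      F.IsHomogeneous n ∧ MvPolynomial.eval x F = a := by
  induction n with
  | zero => exact fun a _ => ⟨MvPolynomial.C a, MvPolynomial.isHomogeneous_C _ _, by simp⟩
  | succ n ih =>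
    intro a ha
    rw [pow_succ] at ha
    induction ha using Submodule.mul_induction_on' with
    | mem_mul_mem b hb c hc =>
      obtain ⟨F, hF, rfl⟩ := ih b hb
      have : ∃ L : MvPolynomial σ R, L.IsHomogeneous 1 ∧ MvPolynomial.eval x L = c := by
        induction hc using Submodule.span_induction with
        | mem y hy =>
          obtain ⟨j, rfl⟩ := hy
          exact ⟨MvPolynomial.X j, MvPolynomial.isHomogeneous_X _ _, by simp⟩
        | zero => exact ⟨0, MvPolynomial.isHomogeneous_zero _ _ _, by simp⟩
        | add y z _ _ h1 h2 =>
          obtain ⟨L, hL, rfl⟩ := h1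
          obtain ⟨L', hL', rfl⟩ := h2
          exact ⟨L + L', hL.add hL', by simp⟩
        | smul r y _ h1 =>
          obtain ⟨L, hL, rfl⟩ := h1
          exact ⟨MvPolynomial.C r * L, by
            simpa using (MvPolynomial.isHomogeneous_C σ r).mul hL, by simp⟩
      obtain ⟨L, hL, rfl⟩ := this
      exact ⟨F * L, hF.mul hL, by simp⟩
    | add y _ z _ h1 h2 =>
      obtain ⟨L, hL, rfl⟩ := h1
      obtain ⟨L', hL', rfl⟩ := h2
      exact ⟨L + L', hL.add hL', by simp⟩

lemma aux_exists_form_mul {σ R : Type*} [CommRing R] [IsLocalRing R] (x : σ → R)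
    (hx : Ideal.span (Set.range x) = maximalIdeal R) (n : ℕ) (a : R)
    (ha : a ∈ maximalIdeal R ^ (n + 1)) : ∃ F : MvPolynomial σ R,
      F.IsHomogeneous n ∧ MvPolynomial.map (residue R) F = 0 ∧ MvPolynomial.eval x F = a := by
  rw [pow_succ] at ha
  induction ha using Submodule.mul_induction_on' with
  | mem_mul_mem b hb c hc =>
    obtain ⟨F, hF, rfl⟩ := aux_exists_form x n b (by rwa [hx])
    refine ⟨MvPolynomial.C c * F, by simpa using (MvPolynomial.isHomogeneous_C σ c).mul hF, ?_, ?_⟩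
    · rw [map_mul, MvPolynomial.map_C, (residue_eq_zero_iff c).mpr hc]; simp
    · simp [mul_comm]
  | add y _ z _ h1 h2 =>
    obtain ⟨L, hL, e, rfl⟩ := h1
    obtain ⟨L', hL', e', rfl⟩ := h2
    exact ⟨L + L', hL.add hL', by simp [e, e'], by simp⟩

/-- Quasi-regularity of a regular system of parameters. -/
lemma aux_quasiregular {R : Type*} [CommRing R] [IsLocalRing R] [IsNoetherianRing R]
    (s : Finset R) (hs : Ideal.span (s : Set R) = maximalIdeal R)
    (hcard : (s.card : WithBot (WithTop ℕ)) = ringKrullDim R)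
    (n : ℕ) (F : MvPolynomial s R) (hF : F.IsHomogeneous n)
    (h0 : MvPolynomial.eval (fun j : s => (j : R)) F = 0) :
    MvPolynomial.map (residue R) F = 0 := by
  classical
  by_contra hne
  rcases isEmpty_or_nonempty s with hE | ⟨⟨i⟩⟩
  · apply hne
    rw [MvPolynomial.eq_C_of_isEmpty F] at h0 ⊢
    rw [MvPolynomial.eval_C] at h0
    rw [h0]; simp
  let k := ResidueField R
  let π : R[X] →+* k[X] := Polynomial.mapRingHom (residue R)
  have hπ : Function.Surjective π := Polynomial.map_surjective _ residue_surjective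
  have hker : RingHom.ker π = (maximalIdeal R).map C := by
    rw [Polynomial.ker_mapRingHom, ker_residue]
  set P : Ideal R[X] := (maximalIdeal R).map C with hP
  have hPp : P.IsPrime := hker ▸ RingHom.ker_isPrime π
  -- choose the point
  have hne' : MvPolynomial.map (C : k →+* k[X]) (MvPolynomial.map (residue R) F)
      * MvPolynomial.X i ≠ 0 := by
    refine mul_ne_zero (fun h => hne ?_) (MvPolynomial.X_ne_zero i)
    exact MvPolynomial.map_injective _ Polynomial.C_injective (by simpa using h)
  obtain ⟨c', hc'⟩ : ∃ c' : s → k[X], MvPolynomial.eval c'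
      (MvPolynomial.map (C : k →+* k[X]) (MvPolynomial.map (residue R) F)
      * MvPolynomial.X i) ≠ 0 := by
    by_contra! h
    exact hne' (MvPolynomial.funext (by simpa using h))
  choose c hc using fun j => hπ (c' j)
  have hci : c i ∉ P := by
    intro h
    rw [← hker, RingHom.mem_ker, hc] at h
    simp [h] at hc'
  have hFc : MvPolynomial.eval₂ C c F ∉ P := by
    intro h
    rw [← hker, RingHom.mem_ker, MvPolynomial.hom_eval₂] at h
    apply hc'
    rw [map_mul, MvPolynomial.eval_map, MvPolynomial.eval₂_map]
    convert zero_mul _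
    rw [← h]
    congr 1
    · ext; simp [π]
    · ext1 j; simp [hc]
  -- the elements cutting out `P`
  let y : s → R[X] := fun j => c i * C (j : R) - c j * C (i : R)
  let T : Finset R[X] := (Finset.univ.erase i).image y
  have hT : T.card < s.card := by
    refine Finset.card_image_le.trans_lt ?_
    rw [Finset.card_erase_of_mem (Finset.mem_univ _)]
    have : 0 < s.card := Finset.card_pos.mpr ⟨i, i.2⟩
    rw [Finset.card_univ, Fintype.card_coe]; omega
  have hmem : ∀ j : s, C (j : R) ∈ P := fun j =>
    Ideal.mem_map_of_mem _ (hs ▸ Ideal.subset_span j.2)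
  have hmin : P ∈ (Ideal.span (T : Set R[X])).minimalPrimes := by
    refine ⟨⟨hPp, ?_⟩, ?_⟩
    · rw [Ideal.span_le]
      intro z hz
      simp only [T, Finset.coe_image, Set.mem_image] at hz
      obtain ⟨j, _, rfl⟩ := hz
      exact P.sub_mem (P.mul_mem_left _ (hmem j)) (P.mul_mem_left _ (hmem i))
    · rintro Q ⟨hQ, hTQ⟩ hQP
      have hy : ∀ j, y j ∈ Q := by
        intro j
        by_cases hj : j = i
        · subst hj; simp [y]
        · exact hTQ (Ideal.subset_span (by
            simp only [T, Finset.coe_image]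
            exact ⟨j, by simp [hj], rfl⟩))
      let q := Ideal.Quotient.mk Q
      have e1 : ∀ j : s, q (c i) * q (C (j : R)) = q (C (i : R)) * q (c j) := by
        intro j
        rw [← map_mul, ← map_mul, mul_comm (C (i : R))]
        exact Ideal.Quotient.eq.mpr (hy j)
      have e2 : MvPolynomial.eval₂ (q.comp C) (fun j : s => q (C (j : R))) F = 0 := by
        have := congrArg (q.comp C) h0
        rw [map_zero, MvPolynomial.eval, MvPolynomial.coe_eval₂Hom, MvPolynomial.hom_eval₂] at this
        exact this
      have e3 := aux_eval_smul (q.comp C) hF (q (c i)) (fun j : s => q (C (j : R)))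
      have e4 := aux_eval_smul (q.comp C) hF (q (C (i : R))) (fun j : s => q (c j))
      rw [e2, mul_zero] at e3
      simp only [e1] at e3
      rw [e3] at e4
      have e5 : MvPolynomial.eval₂ (q.comp C) (fun j : s => q (c j)) F
          = q (MvPolynomial.eval₂ C c F) := by
        rw [MvPolynomial.hom_eval₂]
      rw [e5, ← map_pow, ← map_mul] at e4
      have e6 : C (i : R) ^ n * MvPolynomial.eval₂ C c F ∈ Q :=
        Ideal.Quotient.eq_zero_iff_mem.mp e4.symm
      have hiQ : C (i : R) ∈ Q :=
        hQ.mem_of_pow_mem _ ((hQ.mem_or_mem e6).resolve_right fun h => hFc (hQP h))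
      rw [hP, ← hs, Ideal.map_span, Ideal.span_le]
      rintro _ ⟨r, hr, rfl⟩
      have h7 : c i * C r ∈ Q := by
        have := Q.add_mem (hy ⟨r, hr⟩) (Q.mul_mem_left (c ⟨r, hr⟩) hiQ)
        simpa [y] using this
      exact (hQ.mem_or_mem h7).resolve_left fun h => hci (hQP h)
  have h8 := Ideal.height_le_card_of_mem_minimalPrimes_span_finset hmin
  rw [hP, Polynomial.height_map_C] at h8
  have h9 : (s.card : WithBot ℕ∞) = ((maximalIdeal R).height : WithBot ℕ∞) :=
    hcard.trans IsLocalRing.maximalIdeal_height_eq_ringKrullDim.symm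
  have h10 : (s.card : ℕ∞) = (maximalIdeal R).height := by exact_mod_cast h9
  rw [← h10] at h8
  have : s.card ≤ T.card := by exact_mod_cast h8
  omega

lemma aux_pow_mem {R : Type*} [CommRing R] [IsLocalRing R] [IsNoetherianRing R]
    (hreg : IsRegularLocal R) (f : R) (j m : ℕ) (hf : f ∈ maximalIdeal R ^ j)
    (hfm : f ^ m ∈ maximalIdeal R ^ (j * m + 1)) : f ∈ maximalIdeal R ^ (j + 1) := by
  obtain ⟨s, hs, hcard⟩ := hreg
  let x : s → R := fun j => (j : R)
  have hx : Ideal.span (Set.range x) = maximalIdeal R := by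
    rw [← hs]; congr 1; simp [x]
  obtain ⟨F, hF, rfl⟩ := aux_exists_form x j f (by rwa [hx])
  obtain ⟨H, hH, hH0, hHe⟩ := aux_exists_form_mul x hx _ _ hfm
  have key := aux_quasiregular s hs hcard (j * m) (F ^ m - H) ((hF.pow m).sub hH) (by
    change MvPolynomial.eval x _ = 0
    rw [map_sub, map_pow, hHe, sub_self])
  rw [map_sub, map_pow, hH0, sub_zero] at key
  have hF0 : MvPolynomial.map (residue R) F = 0 := eq_zero_of_pow_eq_zero key
  rw [MvPolynomial.eval_eq]
  refine Ideal.sum_mem _ fun d hd => ?_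
  have hdeg : d.degree = j := by
    have := hF (MvPolynomial.mem_support_iff.mp hd)
    rw [Finsupp.degree_eq_weight_one]; exact this
  rw [pow_succ']
  refine Ideal.mul_mem_mul ?_ ?_
  · rw [← residue_eq_zero_iff, ← MvPolynomial.coeff_map, hF0]; simp
  · have : ∏ i ∈ d.support, x i ^ d i ∈ ∏ i ∈ d.support, maximalIdeal R ^ d i :=
      Ideal.prod_mem_prod fun i _ => Ideal.pow_mem_pow (hx ▸ Ideal.subset_span ⟨i, rfl⟩) _
    rwa [Finset.prod_pow_eq_pow_sum, show ∑ i ∈ d.support, d i = j from hdeg] at this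

lemma aux_integral {R : Type*} [CommRing R] [IsLocalRing R] [IsNoetherianRing R]
    (hreg : IsRegularLocal R) (G : Subalgebra R (Polynomial R))
    (hg : IsGradedSub G) (hG : SingCond G) (k : ℕ) (c : R)
    (hc : IsIntegral G (C c * X ^ k : R[X])) : c ∈ maximalIdeal R ^ k := by
  obtain ⟨p, hp, hpe⟩ := hc
  have hsing : ∀ (g : G) (l : ℕ), (g : R[X]).coeff l ∈ maximalIdeal R ^ l := by
    intro g l
    rcases Nat.eq_zero_or_pos l with rfl | hl
    · simp
    · exact hG l hl _ (hg g g.2 l)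
  have hrel : c ^ p.natDegree + ∑ i ∈ Finset.range p.natDegree,
      ((p.coeff i : G) : R[X]).coeff (k * (p.natDegree - i)) * c ^ i = 0 := by
    rw [Polynomial.eval₂_eq_sum_range, Finset.sum_range_succ] at hpe
    have h := congrArg (fun q : R[X] => q.coeff (k * p.natDegree)) hpe
    simp only [Polynomial.coeff_add, Polynomial.finsetSum_coeff, Polynomial.coeff_zero] at h
    rw [add_comm, ← h]
    congr 1
    · refine Finset.sum_congr rfl fun i hi => ?_
      have hi' : i < p.natDegree := Finset.mem_range.mp hi
      have : k * p.natDegree = k * (p.natDegree - i) + k * i := by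
        rw [← Nat.mul_add]; congr 1; omega
      rw [this, mul_pow, ← C_pow, ← pow_mul, ← mul_assoc, Polynomial.coeff_mul_X_pow,
        Polynomial.coeff_mul_C]
      rfl
    · rw [mul_pow, ← C_pow, ← pow_mul, ← mul_assoc, hp.coeff_natDegree, map_one, one_mul,
        Polynomial.coeff_C_mul, Polynomial.coeff_X_pow_self, mul_one]
  have main : ∀ j ≤ k, c ∈ maximalIdeal R ^ j := by
    intro j
    induction j with
    | zero => simp
    | succ j ih =>
      intro hj
      have hcj := ih (by omega)
      refine aux_pow_mem hreg c j p.natDegree hcj ?_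
      rw [eq_neg_of_add_eq_zero_left hrel]
      refine neg_mem (Ideal.sum_mem _ fun i hi => ?_)
      have hi' : i < p.natDegree := Finset.mem_range.mp hi
      have h1 := Ideal.mul_mem_mul (hsing (p.coeff i) (k * (p.natDegree - i)))
        (Ideal.pow_mem_pow hcj i)
      rw [← pow_mul, ← pow_add] at h1
      refine Ideal.pow_le_pow_right ?_ h1
      obtain ⟨e, he⟩ := Nat.exists_eq_add_of_lt hi'
      rw [he, show i + e + 1 - i = e + 1 by omega]
      nlinarith [Nat.mul_le_mul_right (e + 1) hj]
  exact main k le_rfl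

/-- if two graded subalgebras of `R[W]` have the same integral
closure in `R[W]`, then the singular condition holds for one iff it holds
for the other. -/
theorem stmt5 {R : Type*} [CommRing R] [IsLocalRing R] [IsNoetherianRing R]
    (hreg : IsRegularLocal R) (G G' : Subalgebra R (Polynomial R))
    (hg : IsGradedSub G) (hg' : IsGradedSub G')
    (hcl : ∀ x : Polynomial R, IsIntegral G x ↔ IsIntegral G' x) :
    SingCond G ↔ SingCond G' := by
  constructor
  · intro h k _ c hc
    exact aux_integral hreg G hg h k c
      ((hcl _).mpr (isIntegral_algebraMap (R := G') (x := (⟨_, hc⟩ : G'))))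
  · intro h k _ c hc
    exact aux_integral hreg G' hg' h k c
      ((hcl _).mp (isIntegral_algebraMap (R := G) (x := (⟨_, hc⟩ : G))))
end

section
/- Let R be a regular local ring with maximal ideal M and let G ⊆ G' be graded subalgebras of R[W] such that G' is integral over G. Assume the Sing condition holds (ord of the degree-k piece is ≥ k for all k, for both algebras). Then ord_G = ord_{G'}, i.e. inf_k ord(I_k)/k = inf_k ord(I'_k)/k, where I_k and I'_k denote the degree-k pieces of G and G'. -/
open IsLocalRing

open Polynomial

/-- The `M`-adic order of a set of elements. -/
noncomputable def ordS {R : Type*} [CommRing R] [IsLocalRing R] (A : Set R) : ℕ :=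
  sSup {t : ℕ | A ⊆ ↑(maximalIdeal R ^ t)}

/-- The set of values `ord(I_k)/k` over `k ≥ 1` with nonzero graded piece
`I_k` of `G`. -/
noncomputable def ordValues {R : Type*} [CommRing R] [IsLocalRing R]
    (G : Subalgebra R (Polynomial R)) : Set ℝ :=
  {q | ∃ k : ℕ, 1 ≤ k ∧ (∃ c : R, c ≠ 0 ∧ C c * X ^ k ∈ G) ∧
    q = (ordS {c : R | C c * X ^ k ∈ G} : ℝ) / (k : ℝ)}

lemma aux_eval_hom {A B ι : Type*} [CommRing A] [CommRing B] (π : A →+* B)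
    (F : MvPolynomial ι A) (d : ℕ) (hF : F.IsHomogeneous d) (a : ι → B) (u : B) :
    MvPolynomial.eval₂ π (fun j => a j * u) F = MvPolynomial.eval₂ π a F * u ^ d := by
  classical
  rw [MvPolynomial.eval₂_eq, MvPolynomial.eval₂_eq, Finset.sum_mul]
  refine Finset.sum_congr rfl fun m hm => ?_
  have h := hF (MvPolynomial.mem_support_iff.mp hm)
  rw [Finsupp.weight_apply] at h
  simp only [Pi.one_apply, smul_eq_mul, mul_one, Finsupp.sum] at h
  simp_rw [mul_pow]
  rw [Finset.prod_mul_distrib, Finset.prod_pow_eq_pow_sum, h, mul_assoc]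

lemma aux_A {R ι : Type*} [CommRing R] [IsLocalRing R] [IsNoetherianRing R] [Fintype ι]
    [Infinite (ResidueField R)] (x : ι → R) (hx : Ideal.span (Set.range x) = maximalIdeal R)
    (hdim : (Fintype.card ι : WithBot ℕ∞) = ringKrullDim R)
    (F : MvPolynomial ι R) (d : ℕ) (hF : F.IsHomogeneous d)
    (hF0 : MvPolynomial.map (residue R) F ≠ 0) :
    MvPolynomial.eval x F ∉ maximalIdeal R ^ (d + 1) := by
  classical
  intro hmem
  obtain ⟨a', ha'⟩ : ∃ a' : ι → ResidueField R,
      MvPolynomial.eval a' (MvPolynomial.map (residue R) F) ≠ 0 := by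
    by_contra! h
    exact hF0 (MvPolynomial.funext fun a => by simpa using h a)
  choose a ha using fun j => residue_surjective (R := R) (a' j)
  have hFa : IsUnit (MvPolynomial.eval a F) := by
    rw [← residue_ne_zero_iff_isUnit]
    have : residue R (MvPolynomial.eval a F) =
        MvPolynomial.eval a' (MvPolynomial.map (residue R) F) := by
      rw [MvPolynomial.eval_map, ← funext ha]
      simp [MvPolynomial.eval₂_eq, MvPolynomial.eval_eq]
    rwa [this]
  by_cases hd : d = 0
  · subst hd
    have e1 := aux_eval_hom (RingHom.id R) F 0 hF a 0
    have e2 := aux_eval_hom (RingHom.id R) F 0 hF x 0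
    simp only [mul_zero, pow_zero, mul_one] at e1 e2
    have e3 : MvPolynomial.eval a F = MvPolynomial.eval x F := e1.symm.trans e2
    rw [e3] at hFa
    rw [zero_add, pow_one] at hmem
    exact hmem hFa
  obtain ⟨i, hi⟩ : ∃ i, a' i ≠ 0 := by
    by_contra! h
    apply ha'
    have h2 := aux_eval_hom (residue R) F d hF a' 0
    have h3 : (fun j => a' j * 0) = a' := by ext j; simp [h j]
    rw [h3, zero_pow hd, mul_zero] at h2
    rwa [MvPolynomial.eval_map]
  have hai : IsUnit (a i) := by
    rw [← residue_ne_zero_iff_isUnit, ha]; exact hi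
  obtain ⟨b, hb⟩ := hai.exists_right_inv
  let y : ι → R := fun j => x j - a j * (b * x i)
  have hyi : y i = 0 := by
    simp only [y]; linear_combination -(x i) * hb
  let s : Finset R := (Finset.univ.erase i).image y
  let J : Ideal R := Ideal.span (s : Set R)
  have hyJ : ∀ j, y j ∈ J := by
    intro j
    by_cases hj : j = i
    · rw [hj, hyi]; exact zero_mem _
    · exact Ideal.subset_span (by simp only [s, Finset.coe_image]; exact ⟨j, by simp [hj], rfl⟩)
  have hxM : ∀ j, x j ∈ maximalIdeal R := fun j => hx ▸ Ideal.subset_span ⟨j, rfl⟩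
  have hyM : ∀ j, y j ∈ maximalIdeal R := fun j =>
    sub_mem (hxM j) (Ideal.mul_mem_left _ _ (Ideal.mul_mem_left _ _ (hxM i)))
  have hJM : J ≤ maximalIdeal R := by
    rw [Ideal.span_le]
    intro z hz
    simp only [s, Finset.coe_image] at hz
    obtain ⟨j, -, rfl⟩ := hz
    exact hyM j
  let π := Ideal.Quotient.mk J
  let u := π (b * x i)
  have hπx : ∀ j, π (x j) = π (a j) * u := by
    intro j
    rw [← map_mul]
    exact Ideal.Quotient.eq.mpr (hyJ j)
  have hmapM : (maximalIdeal R).map π = Ideal.span {u} := by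
    apply le_antisymm
    · rw [← hx, Ideal.map_span, Ideal.span_le]
      rintro _ ⟨_, ⟨j, rfl⟩, rfl⟩
      rw [hπx]
      exact Ideal.mul_mem_left _ _ (Ideal.mem_span_singleton_self u)
    · rw [Ideal.span_singleton_le_iff_mem]
      exact Ideal.mem_map_of_mem _ (Ideal.mul_mem_left _ _ (hxM i))
  have h1 : π (MvPolynomial.eval x F) = π (MvPolynomial.eval a F) * u ^ d := by
    have e : ∀ z : ι → R, π (MvPolynomial.eval z F) = MvPolynomial.eval₂ π (fun j => π (z j)) F := by
      intro z
      simp [MvPolynomial.eval₂_eq, MvPolynomial.eval_eq]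
    rw [e, e, ← aux_eval_hom π F d hF]
    simp_rw [hπx]
  have h2 : π (MvPolynomial.eval a F) * u ^ d ∈ Ideal.span {u ^ (d + 1)} := by
    rw [← Ideal.span_singleton_pow, ← hmapM, ← Ideal.map_pow, ← h1]
    exact Ideal.mem_map_of_mem _ hmem
  obtain ⟨c, hc⟩ := Ideal.mem_span_singleton.mp h2
  obtain ⟨c, rfl⟩ := Ideal.Quotient.mk_surjective c
  have hunit : IsUnit (MvPolynomial.eval a F - b * x i * c) := by
    by_contra hn
    have h3 : MvPolynomial.eval a F - b * x i * c ∈ maximalIdeal R := hn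
    have h4 : b * x i * c ∈ maximalIdeal R :=
      Ideal.mul_mem_right _ _ (Ideal.mul_mem_left _ _ (hxM i))
    have h5 := add_mem h3 h4
    rw [sub_add_cancel] at h5
    exact h5 hFa
  have hud : u ^ d = 0 := by
    have h3 := hunit.map π
    rw [map_sub, map_mul] at h3
    refine h3.mul_left_eq_zero.mp ?_ 
    change u ^ d * (π (MvPolynomial.eval a F) - u * π c) = 0
    linear_combination hc
  have hMd : maximalIdeal R ^ d ≤ J := by
    have h3 : (maximalIdeal R ^ d).map π = ⊥ := by
      rw [Ideal.map_pow, hmapM, Ideal.span_singleton_pow, hud]; simp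
    rw [Ideal.map_eq_bot_iff_le_ker, Ideal.mk_ker] at h3
    exact h3
  have hmin : maximalIdeal R ∈ J.minimalPrimes := by
    refine ⟨⟨inferInstance, hJM⟩, fun q hq _ => ?_⟩
    have := hq.1
    exact fun z hz => hq.1.mem_of_pow_mem d (hq.2 (hMd (Ideal.pow_mem_pow hz d)))
  have hht := Ideal.height_le_card_of_mem_minimalPrimes_span_finset hmin
  have hcard : s.card < Fintype.card ι := by
    refine lt_of_le_of_lt Finset.card_image_le ?_
    rw [Finset.card_erase_of_mem (Finset.mem_univ i), Finset.card_univ]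
    have : 0 < Fintype.card ι := Fintype.card_pos_iff.mpr ⟨i⟩
    omega
  rw [← maximalIdeal_height_eq_ringKrullDim] at hdim
  have h6 : (Fintype.card ι : ℕ∞) = (maximalIdeal R).height := by exact_mod_cast hdim
  rw [← h6] at hht
  have : Fintype.card ι ≤ s.card := by exact_mod_cast hht
  omega

lemma aux_B {R : Type*} [CommRing R] [IsRegularLocalRing R] [Infinite (ResidueField R)]
    (f : R) (d r : ℕ) (hf : f ∈ maximalIdeal R ^ d) (hf' : f ∉ maximalIdeal R ^ (d + 1)) :
    f ^ r ∉ maximalIdeal R ^ (d * r + 1) := by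
  obtain ⟨s, hs, hsp⟩ := 
    Submodule.FG.exists_span_finset_card_eq_spanFinrank (maximalIdeal R).fg_of_isNoetherianRing
  have hdim := IsRegularLocalRing.spanFinrank_maximalIdeal (R := R)
  let x : s → R := fun j => j
  have hx : Ideal.span (Set.range x) = maximalIdeal R := by
    simpa [x] using hsp
  have hf1 := hf
  rw [← hx, Ideal.mem_span_pow_iff_exists_isHomogeneous] at hf1
  obtain ⟨F, hF, rfl⟩ := hf1
  rw [← map_pow]
  refine aux_A x hx (by rw [← hdim, ← hs]; simp) _ _ (hF.pow r) ?_
  rw [map_pow]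
  refine pow_ne_zero _ fun h0 => hf' ?_
  rw [MvPolynomial.eval_eq]
  refine sum_mem fun m hm => ?_
  have h := hF (MvPolynomial.mem_support_iff.mp hm)
  rw [Finsupp.weight_apply] at h
  simp only [Pi.one_apply, smul_eq_mul, mul_one, Finsupp.sum] at h
  rw [pow_succ', ← h, ← Finset.prod_pow_eq_pow_sum]
  refine Ideal.mul_mem_mul ?_ (Ideal.prod_mem_prod fun j _ => Ideal.pow_mem_pow (hx ▸ Ideal.subset_span ⟨j, rfl⟩) _)
  have := congrArg (MvPolynomial.coeff m) h0
  rw [MvPolynomial.coeff_map, MvPolynomial.coeff_zero, residue_eq_zero_iff] at this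
  exact this

open Polynomial in
lemma aux_C {R : Type*} [CommRing R] [IsRegularLocalRing R]
    (f : R) (d r : ℕ) (hf : f ∈ maximalIdeal R ^ d) (hf' : f ∉ maximalIdeal R ^ (d + 1)) :
    f ^ r ∉ maximalIdeal R ^ (d * r + 1) := by
  let p : Ideal R[X] := (maximalIdeal R).map C
  have hp : p.IsPrime := Ideal.isPrime_map_C_of_isPrime
  let S := Localization.AtPrime p
  have hreg : IsRegularLocalRing S :=
    Polynomial.isRegularLocalRing_localization_atPrime_of_comap_eq_maximalIdeal R p (by
      ext z
      rw [Ideal.mem_comap, Ideal.mem_map_C_iff]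
      constructor
      · intro h; simpa using h 0
      · intro h n
        rw [coeff_C]; split_ifs
        · exact h
        · exact zero_mem _)
  have hmap : p.map (algebraMap R[X] S) = maximalIdeal S := Localization.AtPrime.map_eq_maximalIdeal
  have hinf : Infinite (ResidueField S) := by
    refine Infinite.of_injective (fun n : ℕ => residue S (algebraMap R[X] S (X ^ n))) ?_
    intro m n hmn
    by_contra hne
    simp only at hmn
    rw [← sub_eq_zero, ← map_sub, ← map_sub, residue_eq_zero_iff,
      IsLocalization.AtPrime.to_map_mem_maximal_iff S p, Ideal.mem_map_C_iff] at hmn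
    have := hmn m
    rw [coeff_sub, coeff_X_pow_self, coeff_X_pow, if_neg hne, sub_zero] at this
    exact (Ideal.ne_top_iff_one _).mp (maximalIdeal.isMaximal R).ne_top this
  have key : ∀ (g : R) (k : ℕ), algebraMap R[X] S (C g) ∈ maximalIdeal S ^ k ↔
      g ∈ maximalIdeal R ^ k := by
    intro g k
    rw [← hmap, ← Ideal.map_pow, ← Ideal.map_pow]
    constructor
    · intro h
      rw [IsLocalization.algebraMap_mem_map_algebraMap_iff p.primeCompl] at h
      obtain ⟨t, ht, htg⟩ := h
      have ht' : t ∉ p := ht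
      rw [Ideal.mem_map_C_iff] at ht' htg
      push Not at ht'
      obtain ⟨n, hn⟩ := ht'
      have h1 := htg n
      rw [coeff_mul_C] at h1
      have hu : IsUnit (t.coeff n) := by by_contra hc; exact hn hc
      exact (Ideal.unit_mul_mem_iff_mem _ hu).mp h1
    · intro h
      exact Ideal.mem_map_of_mem _ (Ideal.mem_map_of_mem _ h)
  rw [← key] at hf hf' ⊢
  rw [map_pow, map_pow]
  exact aux_B _ d r hf hf'

lemma aux_D {R : Type*} [CommRing R] [IsLocalRing R] [IsNoetherianRing R] (h : IsRegularLocal R) :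
    IsRegularLocalRing R := by
  obtain ⟨s, hs, hc⟩ := h
  apply IsRegularLocalRing.of_spanFinrank_maximalIdeal_le
  refine le_trans ?_ hc.le
  rw [← hs]
  have := Submodule.spanFinrank_span_le_ncard_of_finite (R := R) s.finite_toSet
  rw [Set.ncard_coe_finset] at this
  exact Nat.cast_le.mpr this

lemma aux_bdd {R : Type*} [CommRing R] [IsLocalRing R] [IsNoetherianRing R] (A : Set R)
    (c : R) (hc : c ≠ 0) (hcA : c ∈ A) : BddAbove {t : ℕ | A ⊆ ↑(maximalIdeal R ^ t)} := by
  obtain ⟨N, hN⟩ : ∃ N, c ∉ maximalIdeal R ^ N := by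
    by_contra! h
    have h1 := Ideal.iInf_pow_eq_bot_of_isLocalRing (maximalIdeal R)
      (maximalIdeal.isMaximal R).ne_top
    have h2 : c ∈ (⨅ i : ℕ, maximalIdeal R ^ i) := by simpa using h
    rw [h1] at h2
    exact hc h2
  refine ⟨N, fun t ht => ?_⟩
  by_contra! hlt
  exact hN (Ideal.pow_le_pow_right hlt.le (ht hcA))

lemma aux_ordS_le {R : Type*} [CommRing R] [IsLocalRing R] (A : Set R)
    (c : R) (hcA : c ∈ A) (t : ℕ) (hc : c ∉ maximalIdeal R ^ (t + 1)) : ordS A ≤ t := by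
  refine csSup_le ⟨0, by simp⟩ fun n hn => ?_
  by_contra! hlt
  exact hc (Ideal.pow_le_pow_right hlt (hn hcA))

lemma aux_ordS_spec {R : Type*} [CommRing R] [IsLocalRing R] [IsNoetherianRing R] (A : Set R)
    (c : R) (hc : c ≠ 0) (hcA : c ∈ A) :
    ∃ f ∈ A, f ∈ maximalIdeal R ^ ordS A ∧ f ∉ maximalIdeal R ^ (ordS A + 1) := by
  have hb := aux_bdd A c hc hcA
  have h1 : A ⊆ ↑(maximalIdeal R ^ ordS A) :=
    Nat.sSup_mem (s := {t : ℕ | A ⊆ ↑(maximalIdeal R ^ t)}) ⟨0, by simp⟩ hb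
  by_contra! h
  have h2 : ordS A + 1 ≤ ordS A := le_csSup hb (show _ ∈ {t : ℕ | A ⊆ ↑(maximalIdeal R ^ t)} from
    fun f hf => h f hf (h1 hf))
  omega

/-- The homogeneous integral equation. -/
lemma aux_int {R : Type*} [CommRing R] (G : Subalgebra R (Polynomial R))
    (hg : IsGradedSub G) (f : R) (n : ℕ) (hint : IsIntegral G (C f * X ^ n : R[X])) :
    ∃ (r : ℕ) (a : ℕ → R), (∀ j < r, C (a j) * X ^ (n * (r - j)) ∈ G) ∧
      f ^ r + ∑ j ∈ Finset.range r, a j * f ^ j = 0 := by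
  obtain ⟨p, hp, hp0⟩ := hint
  refine ⟨p.natDegree, fun j => (p.coeff j : R[X]).coeff (n * (p.natDegree - j)),
    fun j _ => hg _ (p.coeff j).2 _, ?_⟩
  rw [Polynomial.eval₂_eq_sum_range, Finset.sum_range_succ] at hp0
  have h := congrArg (fun q : R[X] => q.coeff (n * p.natDegree)) hp0
  simp only [coeff_add, finset_sum_coeff, coeff_zero] at h
  have e : ∀ j ≤ p.natDegree, (algebraMap G R[X] (p.coeff j) * (C f * X ^ n) ^ j).coeff
      (n * p.natDegree) = (p.coeff j : R[X]).coeff (n * (p.natDegree - j)) * f ^ j := by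
    intro j hj
    have h1 : n * p.natDegree = n * (p.natDegree - j) + n * j := by
      rw [← mul_add, Nat.sub_add_cancel hj]
    rw [mul_pow, ← C_pow, ← pow_mul, ← mul_assoc, h1, coeff_mul_X_pow, coeff_mul_C]
    rfl
  rw [e _ le_rfl, Finset.sum_congr rfl fun j hj => e j (Finset.mem_range.mp hj).le] at h
  have hlead : p.coeff p.natDegree = 1 := hp
  rw [hlead, Nat.sub_self, mul_zero] at h
  simp only [OneMemClass.coe_one, coeff_one_zero, one_mul] at h
  rw [add_comm]
  exact h

/-- if `G ⊆ G'` are graded subalgebras of `R[W]` with `G'`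
integral over `G`, and the singular condition holds for both, then
`ord_G = ord_{G'}`, i.e. `inf_k ord(I_k)/k = inf_k ord(I'_k)/k`. -/
theorem stmt12 {R : Type*} [CommRing R] [IsLocalRing R] [IsNoetherianRing R]
    (hreg : IsRegularLocal R) (G G' : Subalgebra R (Polynomial R)) (hle : G ≤ G')
    (hg : IsGradedSub G) (hg' : IsGradedSub G')
    (hint : ∀ x ∈ G', IsIntegral G x)
    (hSing : ∀ k, 1 ≤ k → ∀ c : R, C c * X ^ k ∈ G → c ∈ maximalIdeal R ^ k)
    (hSing' : ∀ k, 1 ≤ k → ∀ c : R, C c * X ^ k ∈ G' → c ∈ maximalIdeal R ^ k) :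
    sInf (ordValues G) = sInf (ordValues G') := by
  have hR := aux_D hreg
  have hbd : ∀ H : Subalgebra R (Polynomial R), BddBelow (ordValues H) := by
    intro H
    refine ⟨0, ?_⟩
    rintro q ⟨k, -, -, rfl⟩
    positivity
  have h1 : ∀ q ∈ ordValues G, ∃ q' ∈ ordValues G', q' ≤ q := by
    rintro q ⟨k, hk, ⟨c, hc, hcG⟩, rfl⟩
    refine ⟨_, ⟨k, hk, ⟨c, hc, hle hcG⟩, rfl⟩, ?_⟩
    have : ordS {c : R | C c * X ^ k ∈ G'} ≤ ordS {c : R | C c * X ^ k ∈ G} := by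
      obtain ⟨f, hf, -, hf'⟩ := aux_ordS_spec {c : R | C c * X ^ k ∈ G} c hc hcG
      exact aux_ordS_le _ f (hle hf) _ hf'
    gcongr
  have h2 : ∀ q ∈ ordValues G', ∃ q' ∈ ordValues G, q' ≤ q := by
    rintro q ⟨n, hn, ⟨c, hc, hcG⟩, rfl⟩
    obtain ⟨f, hf, hfd, hfd'⟩ := aux_ordS_spec {c : R | C c * X ^ n ∈ G'} c hc hcG
    set d := ordS {c : R | C c * X ^ n ∈ G'} with hd
    obtain ⟨r, a, ha, hrel⟩ := aux_int G hg f n (hint _ hf)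
    have hfr := aux_C f d r hfd hfd'
    obtain ⟨j, hj, hj'⟩ : ∃ j < r, a j * f ^ j ∉ maximalIdeal R ^ (d * r + 1) := by
      by_contra! h
      apply hfr
      rw [eq_neg_of_add_eq_zero_left hrel]
      exact neg_mem (sum_mem fun j hj => h j (Finset.mem_range.mp hj))
    have haj : a j ∉ maximalIdeal R ^ (d * (r - j) + 1) := by
      intro h
      apply hj'
      have e : d * r + 1 = (d * (r - j) + 1) + d * j := by
        rw [add_right_comm, ← mul_add, Nat.sub_add_cancel hj.le]
      rw [e, pow_add, pow_mul (maximalIdeal R) d j]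
      exact Ideal.mul_mem_mul h (Ideal.pow_mem_pow hfd j)
    have haj0 : a j ≠ 0 := fun h => haj (h ▸ zero_mem _)
    have hrj : 0 < r - j := Nat.sub_pos_of_lt hj
    refine ⟨_, ⟨n * (r - j), Nat.mul_pos hn hrj, ⟨a j, haj0, ha j hj⟩, rfl⟩, ?_⟩
    have hle' := aux_ordS_le {c : R | C c * X ^ (n * (r - j)) ∈ G} (a j) (ha j hj) _ haj
    have hle2 : (ordS {c : R | C c * X ^ (n * (r - j)) ∈ G} : ℝ) ≤ d * ((r - j : ℕ) : ℝ) := by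
      exact_mod_cast hle'
    have hn' : (0 : ℝ) < n := by exact_mod_cast hn
    have hrj' : (0 : ℝ) < ((r - j : ℕ) : ℝ) := by exact_mod_cast hrj
    rw [Nat.cast_mul, div_le_div_iff₀ (by positivity) hn']
    nlinarith
  rcases (ordValues G).eq_empty_or_nonempty with he | hne
  · have : ordValues G' = ∅ := by
      rw [Set.eq_empty_iff_forall_notMem]
      intro q hq
      obtain ⟨q', hq', -⟩ := h2 q hq
      rw [he] at hq'
      exact hq'
    rw [he, this]
  · have hne' : (ordValues G').Nonempty := by
      obtain ⟨q, hq⟩ := hne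
      obtain ⟨q', hq', -⟩ := h1 q hq
      exact ⟨q', hq'⟩
    apply le_antisymm
    · refine le_csInf hne' fun q hq => ?_
      obtain ⟨q', hq', hle'⟩ := h2 q hq
      exact (csInf_le (hbd _) hq').trans hle'
    · refine le_csInf hne fun q hq => ?_
      obtain ⟨q', hq', hle'⟩ := h1 q hq
      exact (csInf_le (hbd _) hq').trans hle'
end
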